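/- Each component of the longitudinal efficient influence function has mean zero: for every t ∈ {1, …, K+1}, E_p[ H^d_t(ā(t−1), l̄(t−1)) · (Q̄^d_{t+1}(l̄(t)) − Q̄^d_t(l̄(t−1))) ] = 0, and also E_p[ Q̄^d_1(l_0) − Q̄^d_0 ] = 0; consequently E_p[D^{*,d}] = 0. -/

import Mathlib

/-!
Longitudinal data structure `O = (L(0), A(0), …, A(K), L(K+1))` with full-support pmf `p`.
Histories are encoded by full trajectories together with agreement predicates on time prefixes;
a sum over histories `l̄(t)` is encoded as a sum over full covariate trajectories whose
coordinates beyond `t` are pinned to an arbitrary base point `l₀` (`tailEq`).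
-/

open Finset
open scoped Classical

noncomputable section

variable {K : ℕ} {L : Fin (K + 2) → Type} {A : Fin (K + 1) → Type}

/-- Covariate trajectories. -/
abbrev Traj (K : ℕ) (L : Fin (K + 2) → Type) : Type := ∀ s : Fin (K + 2), L s

/-- Treatment trajectories. -/
abbrev Trt (K : ℕ) (A : Fin (K + 1) → Type) : Type := ∀ s : Fin (K + 1), A s

/-- Observations. -/
abbrev Obs (K : ℕ) (L : Fin (K + 2) → Type) (A : Fin (K + 1) → Type) : Type :=
  Traj K L × Trt K A

/-- Agreement of covariate trajectories on time indices `< t` (i.e. they share `l̄(t-1)`). -/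
def aL (t : ℕ) (l l' : Traj K L) : Prop := ∀ s : Fin (K + 2), (s : ℕ) < t → l s = l' s

/-- Agreement of treatment trajectories on time indices `< t` (i.e. they share `ā(t-1)`). -/
def aA (t : ℕ) (a a' : Trt K A) : Prop := ∀ s : Fin (K + 1), (s : ℕ) < t → a s = a' s

variable [∀ t, Fintype (L t)] [∀ t, Fintype (A t)]

/-- Mass of the event that the covariates agree with `l` on indices `< tL` and the treatments
agree with `a` on indices `< tA`. -/
def marg (p : Obs K L A → ℝ) (tL tA : ℕ) (l : Traj K L) (a : Trt K A) : ℝ :=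
  ∑ o' : Obs K L A, if aL tL l o'.1 ∧ aA tA a o'.2 then p o' else 0

/-- The conditional factor `q_t(l_t ∣ l̄(t-1), ā(t-1))`. -/
def qC (p : Obs K L A → ℝ) (t : ℕ) (l : Traj K L) (a : Trt K A) : ℝ :=
  marg p (t + 1) t l a / marg p t t l a

/-- The treatment mechanism factor `g_t(a_t ∣ l̄(t), ā(t-1))`. -/
def gC (p : Obs K L A → ℝ) (t : ℕ) (l : Traj K L) (a : Trt K A) : ℝ :=
  marg p (t + 1) (t + 1) l a / marg p (t + 1) t l a

/-- The cumulative treatment probability `g_{0:t-1}(ā(t-1), l̄(t-1))`; in particular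
`gCum p 0 = 1` is the convention `g_{0:-1} = 1`. -/
def gCum (p : Obs K L A → ℝ) (t : ℕ) (l : Traj K L) (a : Trt K A) : ℝ :=
  ∏ m ∈ Finset.range t, gC p m l a

/-- The treatment trajectory determined by the regimen `d` along the covariates `l`. -/
def aOf (d : ∀ t : Fin (K + 1), Traj K L → A t) (l : Traj K L) : Trt K A := fun s => d s l

/-- A regimen is adapted: `d_t` depends only on `l̄(t)`. -/
def Adapted (d : ∀ t : Fin (K + 1), Traj K L → A t) : Prop :=
  ∀ t : Fin (K + 1), ∀ l l' : Traj K L, aL ((t : ℕ) + 1) l l' → d t l = d t l'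

/-- The event `ā(t-1) = d(l̄(t-1))`. -/
def follows (d : ∀ t : Fin (K + 1), Traj K L → A t) (t : ℕ) (o : Obs K L A) : Prop :=
  ∀ s : Fin (K + 1), (s : ℕ) < t → o.2 s = d s o.1

/-- The inverse probability weight
`H^d_t(ā(t-1), l̄(t-1)) = 1{ā(t-1) = d(l̄(t-1))} / g_{0:t-1}`; `Hd p d 0 = 1`. -/
def Hd (p : Obs K L A → ℝ) (d : ∀ t : Fin (K + 1), Traj K L → A t) (t : ℕ)
    (o : Obs K L A) : ℝ :=
  (if follows d t o then (1 : ℝ) else 0) / gCum p t o.1 o.2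

/-- The sequential regression `Q̄^d_t(l̄(t-1))`, defined downward from
`Q̄^d_{K+2}(l̄(K+1)) = y(l_{K+1})` by
`Q̄^d_t(l̄(t-1)) = Σ_{l_t} q_t(l_t ∣ l̄(t-1), d(l̄(t-1))) Q̄^d_{t+1}(l̄(t))`. -/
def Qbar (p : Obs K L A → ℝ) (y : L (Fin.last (K + 1)) → ℝ)
    (d : ∀ t : Fin (K + 1), Traj K L → A t) (t : ℕ) (l : Traj K L) : ℝ :=
  if ht : t < K + 2 then
    ∑ v : L ⟨t, ht⟩,
      qC p t (Function.update l ⟨t, ht⟩ v) (aOf d (Function.update l ⟨t, ht⟩ v)) *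
        Qbar p y d (t + 1) (Function.update l ⟨t, ht⟩ v)
  else y (l (Fin.last (K + 1)))
termination_by K + 2 - t
decreasing_by omega

/-- The G-computation mass `P^d_t(l̄(t)) = Π_{m=0}^{t} q_m(l_m ∣ l̄(m-1), d(l̄(m-1)))`. -/
def Pd (p : Obs K L A → ℝ) (d : ∀ t : Fin (K + 1), Traj K L → A t) (t : ℕ)
    (l : Traj K L) : ℝ :=
  ∏ m ∈ Finset.range (t + 1), qC p m l (aOf d l)

/-- `l` agrees with the base point `l₀` on indices `> t`: summing a function of `l̄(t)` over
trajectories pinned to `l₀` beyond `t` realizes the sum over histories `l̄(t)`. -/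
def tailEq (t : ℕ) (l₀ l : Traj K L) : Prop := ∀ s : Fin (K + 2), t < (s : ℕ) → l s = l₀ s

/-- The `t`-th component of the efficient influence function,
`D^{*,d}_t = H^d_t · (Q̄^d_{t+1} - Q̄^d_t)` (with `H^d_0 = 1`, so the `t = 0` component is
`Q̄^d_1(l_0) - Q̄^d_0`). -/
def Dst (p : Obs K L A → ℝ) (y : L (Fin.last (K + 1)) → ℝ)
    (d : ∀ t : Fin (K + 1), Traj K L → A t) (t : ℕ) (o : Obs K L A) : ℝ :=
  Hd p d t o * (Qbar p y d (t + 1) o.1 - Qbar p y d t o.1)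

set_option linter.unusedSectionVars false

lemma aL_symm {t : ℕ} {l l' : Traj K L} (h : aL t l l') : aL t l' l :=
  fun s hs => (h s hs).symm

lemma aL_trans {t : ℕ} {l l' l'' : Traj K L} (h : aL t l l') (h' : aL t l' l'') : aL t l l'' :=
  fun s hs => (h s hs).trans (h' s hs)

lemma aL_mono {t u : ℕ} (htu : t ≤ u) {l l' : Traj K L} (h : aL u l l') : aL t l l' :=
  fun s hs => h s (hs.trans_le htu)

lemma aA_symm {t : ℕ} {a a' : Trt K A} (h : aA t a a') : aA t a' a :=
  fun s hs => (h s hs).symm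

lemma aA_trans {t : ℕ} {a a' a'' : Trt K A} (h : aA t a a') (h' : aA t a' a'') : aA t a a'' :=
  fun s hs => (h s hs).trans (h' s hs)

lemma aA_mono {t u : ℕ} (htu : t ≤ u) {a a' : Trt K A} (h : aA u a a') : aA t a a' :=
  fun s hs => h s (hs.trans_le htu)

lemma aL_update {t : ℕ} (ht : t < K + 2) (l : Traj K L) (v : L ⟨t, ht⟩) :
    aL t (Function.update l ⟨t, ht⟩ v) l := by
  intro s hs
  exact Function.update_of_ne (fun h => by simp [h] at hs) _ _

lemma aL_succ_update_iff {t : ℕ} (ht : t < K + 2) (l l' : Traj K L) (v : L ⟨t, ht⟩) :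
    aL (t + 1) (Function.update l ⟨t, ht⟩ v) l' ↔ aL t l l' ∧ v = l' ⟨t, ht⟩ := by
  constructor
  · intro h
    refine ⟨aL_trans (aL_symm (aL_update ht l v)) (aL_mono (Nat.le_succ t) h), ?_⟩
    simpa using h ⟨t, ht⟩ (Nat.lt_succ_self t)
  · rintro ⟨h, rfl⟩ s hs
    rcases Nat.lt_succ_iff_lt_or_eq.mp hs with hs | hs
    · exact aL_trans (aL_update ht l _) h s hs
    · obtain rfl : s = ⟨t, ht⟩ := Fin.ext hs
      simp

lemma aA_aOf {d : ∀ t : Fin (K + 1), Traj K L → A t} (hd : Adapted d) {t : ℕ}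
    {l l' : Traj K L} (h : aL t l l') : aA t (aOf d l) (aOf d l') :=
  fun s hs => hd s l l' (aL_mono hs h)

lemma marg_congr (p : Obs K L A → ℝ) {tL tA : ℕ} {l l' : Traj K L} {a a' : Trt K A}
    (hl : aL tL l l') (ha : aA tA a a') : marg p tL tA l a = marg p tL tA l' a' := by
  refine Finset.sum_congr rfl fun o _ => if_congr ?_ rfl rfl
  exact and_congr ⟨aL_trans (aL_symm hl), aL_trans hl⟩ ⟨aA_trans (aA_symm ha), aA_trans ha⟩

lemma marg_pos {p : Obs K L A → ℝ} (hp : ∀ o, 0 < p o) (tL tA : ℕ) (l : Traj K L)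
    (a : Trt K A) : 0 < marg p tL tA l a := by
  refine Finset.sum_pos' (fun o _ => ?_) ⟨(l, a), Finset.mem_univ _, ?_⟩
  · split_ifs
    exacts [(hp o).le, le_rfl]
  · rw [if_pos ⟨fun _ _ => rfl, fun _ _ => rfl⟩]
    exact hp _

lemma qC_congr (p : Obs K L A → ℝ) {t : ℕ} {l l' : Traj K L} {a a' : Trt K A}
    (hl : aL (t + 1) l l') (ha : aA t a a') : qC p t l a = qC p t l' a' := by
  rw [qC, qC, marg_congr p hl ha, marg_congr p (aL_mono (Nat.le_succ t) hl) ha]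

lemma gCum_congr (p : Obs K L A → ℝ) {t : ℕ} {l l' : Traj K L} {a a' : Trt K A}
    (hl : aL t l l') (ha : aA t a a') : gCum p t l a = gCum p t l' a' := by
  refine Finset.prod_congr rfl fun m hm => ?_
  have hm : m + 1 ≤ t := Finset.mem_range.mp hm
  rw [gC, gC, marg_congr p (aL_mono hm hl) (aA_mono hm ha),
    marg_congr p (aL_mono hm hl) (aA_mono (Nat.le_of_succ_le hm) ha)]

lemma Hd_congr (p : Obs K L A → ℝ) {d : ∀ t : Fin (K + 1), Traj K L → A t} (hd : Adapted d)
    {t : ℕ} {o o' : Obs K L A} (hl : aL t o.1 o'.1) (ha : aA t o.2 o'.2) :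
    Hd p d t o = Hd p d t o' := by
  have hf : follows d t o ↔ follows d t o' :=
    forall₂_congr fun s hs => by rw [ha s hs, hd s o.1 o'.1 (aL_mono hs hl)]
  rw [Hd, Hd, gCum_congr p hl ha, if_congr hf rfl rfl]

lemma Qbar_congr (p : Obs K L A → ℝ) (y : L (Fin.last (K + 1)) → ℝ)
    {d : ∀ t : Fin (K + 1), Traj K L → A t} (hd : Adapted d) (t : ℕ) {l l' : Traj K L}
    (h : aL t l l') : Qbar p y d t l = Qbar p y d t l' := by
  by_cases ht : t < K + 2
  · rw [Qbar, Qbar, dif_pos ht, dif_pos ht]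
    refine Finset.sum_congr rfl fun v _ => ?_
    have hu : aL (t + 1) (Function.update l ⟨t, ht⟩ v) (Function.update l' ⟨t, ht⟩ v) :=
      (aL_succ_update_iff ht _ _ _).mpr ⟨aL_trans h (aL_symm (aL_update ht l' v)), by simp⟩
    rw [qC_congr p hu (aA_aOf hd (aL_mono (Nat.le_succ t) hu)), Qbar_congr p y hd (t + 1) hu]
  · rw [Qbar, Qbar, dif_neg ht, dif_neg ht, h (Fin.last (K + 1)) (by simp; omega)]
termination_by K + 2 - t

/-- Averaging `f(l̄(t))` against `q_t` is the conditional expectation given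
`(l̄(t-1), ā(t-1))`. -/
lemma sum_qC_mul (p : Obs K L A → ℝ) {t : ℕ} (ht : t < K + 2) {f : Traj K L → ℝ}
    (hf : ∀ l l', aL (t + 1) l l' → f l = f l') (l : Traj K L) (a : Trt K A) :
    ∑ v : L ⟨t, ht⟩,
        qC p t (Function.update l ⟨t, ht⟩ v) a * f (Function.update l ⟨t, ht⟩ v) =
      (∑ o : Obs K L A, if aL t l o.1 ∧ aA t a o.2 then p o * f o.1 else 0) /
        marg p t t l a := by
  have h (v : L ⟨t, ht⟩) :
      qC p t (Function.update l ⟨t, ht⟩ v) a * f (Function.update l ⟨t, ht⟩ v) =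
        (∑ o : Obs K L A, if v = o.1 ⟨t, ht⟩ then
          (if aL t l o.1 ∧ aA t a o.2 then p o * f o.1 else 0) else 0) / marg p t t l a := by
    rw [qC, marg_congr p (aL_update ht l v) (fun _ _ => rfl : aA t a a), div_mul_eq_mul_div,
      marg, Finset.sum_mul]
    congr 1
    refine Finset.sum_congr rfl fun o _ => ?_
    have hiff := aL_succ_update_iff ht l o.1 v
    by_cases hu : aL (t + 1) (Function.update l ⟨t, ht⟩ v) o.1
    · obtain ⟨hl, hv⟩ := hiff.mp hu
      simp only [hu, hl, if_pos hv, true_and, hf _ _ hu, ite_mul, zero_mul]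
    · rw [if_neg fun h => hu h.1, zero_mul]
      split_ifs with hv hl
      exacts [(hu (hiff.mpr ⟨hl.1, hv⟩)).elim, rfl, rfl]
  simp_rw [h, ← Finset.sum_div]
  rw [Finset.sum_comm]
  simp

/-- Tower property for a weight `h(ā(t-1), l̄(t-1))` and a function `f(l̄(t))`. -/
lemma sum_mul_sum_qC_mul {p : Obs K L A → ℝ} (hp : ∀ o, 0 < p o) {t : ℕ} (ht : t < K + 2)
    {f : Traj K L → ℝ} (hf : ∀ l l', aL (t + 1) l l' → f l = f l') {h : Obs K L A → ℝ}
    (hh : ∀ o o' : Obs K L A, aL t o.1 o'.1 → aA t o.2 o'.2 → h o = h o') :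
    ∑ o : Obs K L A, p o * (h o * ∑ v : L ⟨t, ht⟩,
        qC p t (Function.update o.1 ⟨t, ht⟩ v) o.2 * f (Function.update o.1 ⟨t, ht⟩ v)) =
      ∑ o : Obs K L A, p o * (h o * f o.1) := by
  simp_rw [sum_qC_mul p ht hf, Finset.sum_div, Finset.mul_sum]
  rw [Finset.sum_comm]
  refine Finset.sum_congr rfl fun o' _ => ?_
  have hM := (marg_pos hp t t o'.1 o'.2).ne'
  calc _ = ∑ o : Obs K L A, (if aL t o'.1 o.1 ∧ aA t o'.2 o.2 then p o else 0) *
        (h o' * (p o' * f o'.1) / marg p t t o'.1 o'.2) := by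
        refine Finset.sum_congr rfl fun o _ => ?_
        by_cases hR : aL t o.1 o'.1 ∧ aA t o.2 o'.2
        · rw [if_pos hR, if_pos ⟨aL_symm hR.1, aA_symm hR.2⟩, hh o o' hR.1 hR.2,
            marg_congr p hR.1 hR.2]
          ring
        · rw [if_neg hR, if_neg fun h => hR ⟨aL_symm h.1, aA_symm h.2⟩]
          simp
    _ = marg p t t o'.1 o'.2 * (h o' * (p o' * f o'.1) / marg p t t o'.1 o'.2) := by
        rw [← Finset.sum_mul, marg]
    _ = _ := by
        field_simp

lemma Hd_mul_Qbar (p : Obs K L A → ℝ) (y : L (Fin.last (K + 1)) → ℝ)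
    {d : ∀ t : Fin (K + 1), Traj K L → A t} (hd : Adapted d) {t : ℕ} (ht : t < K + 2)
    (o : Obs K L A) :
    Hd p d t o * Qbar p y d t o.1 = Hd p d t o * ∑ v : L ⟨t, ht⟩,
      qC p t (Function.update o.1 ⟨t, ht⟩ v) o.2 *
        Qbar p y d (t + 1) (Function.update o.1 ⟨t, ht⟩ v) := by
  by_cases hfol : follows d t o
  · rw [Qbar, dif_pos ht]
    congr 1
    refine Finset.sum_congr rfl fun v _ => ?_
    have ha : aA t (aOf d (Function.update o.1 ⟨t, ht⟩ v)) o.2 :=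
      aA_trans (aA_aOf hd (aL_update ht o.1 v)) fun s hs => (hfol s hs).symm
    rw [qC_congr p (fun _ _ => rfl) ha]
  · simp [Hd, hfol]

/-- The `t`-th component of the efficient influence function has mean zero. -/
lemma sum_mul_Dst {p : Obs K L A → ℝ} (hp : ∀ o, 0 < p o) (y : L (Fin.last (K + 1)) → ℝ)
    {d : ∀ t : Fin (K + 1), Traj K L → A t} (hd : Adapted d) {t : ℕ} (ht : t < K + 2) :
    ∑ o : Obs K L A, p o * Dst p y d t o = 0 := by
  simp_rw [Dst, mul_sub, Hd_mul_Qbar p y hd ht, Finset.sum_sub_distrib]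
  rw [sum_mul_sum_qC_mul hp ht (fun _ _ => Qbar_congr p y hd (t + 1))
    (fun _ _ => Hd_congr p hd), sub_self]

/-- each component of the longitudinal EIF has mean zero, and hence
`E_p[D^{*,d}] = 0`. -/
theorem eif_components_mean_zero [∀ t, Nonempty (L t)] [∀ t, Nonempty (A t)]
    (p : Obs K L A → ℝ) (hp : ∀ o, 0 < p o) (hp1 : ∑ o : Obs K L A, p o = 1)
    (y : L (Fin.last (K + 1)) → ℝ)
    (d : ∀ t : Fin (K + 1), Traj K L → A t) (hd : Adapted d) :
    (∀ t : ℕ, 1 ≤ t → t ≤ K + 1 →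
      ∑ o : Obs K L A,
        p o * (Hd p d t o * (Qbar p y d (t + 1) o.1 - Qbar p y d t o.1)) = 0) ∧
    (∑ o : Obs K L A, p o * (Qbar p y d 1 o.1 - Qbar p y d 0 o.1)) = 0 ∧
    ∑ o : Obs K L A, p o * (∑ t ∈ Finset.range (K + 2), Dst p y d t o) = 0 := by
  refine ⟨fun t _ ht => sum_mul_Dst hp y hd (Nat.lt_succ_of_le ht), ?_, ?_⟩
  · simpa [Dst, Hd, gCum, follows] using sum_mul_Dst hp y hd (Nat.succ_pos (K + 1))
  · simp_rw [Finset.mul_sum]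
    rw [Finset.sum_comm]
    exact Finset.sum_eq_zero fun t ht => sum_mul_Dst hp y hd (Finset.mem_range.mp ht)

end
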